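/- Well-definedness of the best quality/price privacy level ε̃: Let r(ε) = D(ε)/V_LB(ε) for ε ∈ (0,∞). If additionally lim_{ε→0+} D(ε)/g'(ε) = 0, then r is continuous and strictly positive on (0,∞), r(ε) → 0 as ε → 0+ and as ε → +∞, r attains its maximum on (0,∞), and the set of maximizers of r has a least element (so ε̃ = inf argmax r is itself a maximizer). -/

import Mathlib

open Real Filter

/-- The lower bound `V_LB(ε)` on the value of `ε` units of privacy. -/
noncomputable def VLB (θ : ℝ) (g' : ℝ → ℝ) (ε : ℝ) : ℝ :=
  g' ε * ((Real.exp ε + 1) / Real.exp ε) *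
    ((θ / (2 * θ - 1)) * (Real.exp ε + 1) - 1)

/-- The per-individual Chernoff information `D(ε)`. -/
noncomputable def dExp (θ ε : ℝ) : ℝ :=
  (1/2) * Real.log ((Real.exp ε + 1)^2 /
    (4 * (θ * Real.exp ε + 1 - θ) * ((1 - θ) * Real.exp ε + θ)))

/-- The hypotheses on the privacy cost function `g` (with derivative `g'`). -/
structure ProperCost (g g' : ℝ → ℝ) : Prop where
  conv : ConvexOn ℝ (Set.Ici 0) g
  deriv : ∀ x ∈ Set.Ici (0:ℝ), HasDerivAt g (g' x) x
  derivCont : ContinuousOn g' (Set.Ici 0)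
  mono : MonotoneOn g (Set.Ici 0)
  nonneg : ∀ x ∈ Set.Ici (0:ℝ), 0 ≤ g x
  zero : g 0 = 0
  pos : ∀ x > (0:ℝ), 0 < g x

lemma exists_isLeast_maximizers {f : ℝ → ℝ} (hf : ContinuousOn f (Set.Ioi 0))
    (hpos : ∀ x : ℝ, 0 < x → 0 < f x)
    (h0 : Tendsto f (nhdsWithin 0 (Set.Ioi 0)) (nhds 0)) (htop : Tendsto f atTop (nhds 0)) :
    ∃ a : ℝ, IsLeast {x : ℝ | 0 < x ∧ ∀ y : ℝ, 0 < y → f y ≤ f x} a := by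
  have h1 : 0 < f 1 := hpos 1 one_pos
  obtain ⟨a, ha, ha'⟩ := mem_nhdsGT_iff_exists_Ioo_subset.1 (h0.eventually_lt_const h1)
  obtain ⟨b, hb⟩ := eventually_atTop.1 (htop.eventually_lt_const h1)
  have ha0 : 0 < a := ha
  have hmem : ∀ x, 0 < x → f 1 ≤ f x → x ∈ Set.Icc a b := by
    intro x hx hfx
    refine ⟨?_, ?_⟩
    · by_contra! h
      exact absurd (ha' ⟨hx, h⟩ : f x < f 1) (not_lt.2 hfx)
    · by_contra! h
      exact absurd (hb x h.le) (not_lt.2 hfx)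
  have hcont : ContinuousOn f (Set.Icc a b) := hf.mono fun x hx => ha0.trans_le hx.1
  have h1mem : (1 : ℝ) ∈ Set.Icc a b := hmem 1 one_pos le_rfl
  obtain ⟨m, hm, hmax⟩ := isCompact_Icc.exists_isMaxOn ⟨1, h1mem⟩ hcont
  have hglobal : ∀ y, 0 < y → f y ≤ f m := by
    intro y hy
    rcases le_total (f 1) (f y) with h | h
    · exact hmax (hmem y hy h)
    · exact h.trans (hmax h1mem)
  have hset : {x : ℝ | 0 < x ∧ ∀ y : ℝ, 0 < y → f y ≤ f x} =
      Set.Icc a b ∩ f ⁻¹' Set.Ici (f m) := by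
    ext x
    refine ⟨fun ⟨hx, h⟩ => ⟨hmem x hx (h 1 one_pos), h m (ha0.trans_le hm.1)⟩, fun ⟨hx, h⟩ =>
      ⟨ha0.trans_le hx.1, fun y hy => (hglobal y hy).trans h⟩⟩
  rw [hset]
  exact (isCompact_Icc.of_isClosed_subset (hcont.preimage_isClosed_of_isClosed isClosed_Icc
    isClosed_Ici) Set.inter_subset_left).exists_isLeast ⟨m, hm, le_refl (f m)⟩

lemma ProperCost.div_le_deriv {g g' : ℝ → ℝ} (hg : ProperCost g g') {x : ℝ} (hx : 0 < x) :
    g x / x ≤ g' x := by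
  have h := hg.conv.slope_le_of_hasDerivAt (x := 0) (y := x) Set.self_mem_Ici hx.le hx
    (hg.deriv x hx.le)
  simpa [slope_def_field, hg.zero] using h

lemma ProperCost.deriv_pos {g g' : ℝ → ℝ} (hg : ProperCost g g') {x : ℝ} (hx : 0 < x) :
    0 < g' x :=
  (div_pos (hg.pos x hx) hx).trans_le (hg.div_le_deriv hx)

lemma ProperCost.apply_one_le_deriv {g g' : ℝ → ℝ} (hg : ProperCost g g') {x : ℝ}
    (hx : 1 ≤ x) : g 1 ≤ g' x := by
  have hx0 : 0 < x := one_pos.trans_le hx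
  refine le_trans ?_ (hg.div_le_deriv hx0)
  have h := hg.conv.2 (Set.self_mem_Ici (a := (0 : ℝ))) (Set.mem_Ici.2 hx0.le)
    (sub_nonneg.2 ((div_le_one hx0).2 hx)) (one_div_nonneg.2 hx0.le) (sub_add_cancel _ _)
  simp only [smul_eq_mul, mul_zero, zero_add, hg.zero, one_div, inv_mul_cancel₀ hx0.ne'] at h
  rwa [div_eq_inv_mul]

section Factors

variable {θ ε : ℝ}

lemma half_le_mul_exp_add (hθ : 1/2 < θ) (hε : 0 ≤ ε) :
    (rexp ε + 1) / 2 ≤ θ * rexp ε + 1 - θ := by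
  nlinarith [mul_nonneg (sub_nonneg.2 hθ.le) (sub_nonneg.2 (one_le_exp hε))]

lemma mul_le_one_sub_mul_exp_add (hθ : 1/2 < θ) :
    (1 - θ) * (rexp ε + 1) ≤ (1 - θ) * rexp ε + θ := by
  linarith

lemma chernoff_denom_pos (hθ : 1/2 < θ) (hθ1 : θ < 1) (hε : 0 ≤ ε) :
    0 < 4 * (θ * rexp ε + 1 - θ) * ((1 - θ) * rexp ε + θ) := by
  have hE := exp_pos ε
  have h1 : 0 < θ * rexp ε + 1 - θ :=
    lt_of_lt_of_le (by positivity) (half_le_mul_exp_add hθ hε)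
  have h2 : 0 < (1 - θ) * rexp ε + θ :=
    lt_of_lt_of_le (mul_pos (sub_pos.2 hθ1) (by positivity)) (mul_le_one_sub_mul_exp_add hθ)
  positivity

lemma dExp_pos (hθ : 1/2 < θ) (hθ1 : θ < 1) (hε : 0 < ε) : 0 < dExp θ ε := by
  refine mul_pos (by norm_num) (log_pos ?_)
  rw [one_lt_div (chernoff_denom_pos hθ hθ1 hε.le)]
  have h : 0 < (2 * θ - 1) * (rexp ε - 1) :=
    mul_pos (by linarith) (sub_pos.2 (one_lt_exp_iff.2 hε))
  nlinarith [pow_pos h 2]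

lemma dExp_le (hθ : 1/2 < θ) (hθ1 : θ < 1) (hε : 0 ≤ ε) :
    dExp θ ε ≤ (1/2) * Real.log (1 / (2 * (1 - θ))) := by
  have hden := chernoff_denom_pos hθ hθ1 hε
  have hE := exp_pos ε
  refine mul_le_mul_of_nonneg_left (log_le_log (by positivity) ?_) (by norm_num)
  have hθ' : 0 < 1 - θ := sub_pos.2 hθ1
  rw [div_le_div_iff₀ hden (by positivity)]
  have h := mul_le_mul (half_le_mul_exp_add hθ hε) (mul_le_one_sub_mul_exp_add (ε := ε) hθ)
    (by positivity) (le_trans (by positivity) (half_le_mul_exp_add hθ hε))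
  nlinarith [h]

lemma continuousOn_dExp (hθ : 1/2 < θ) (hθ1 : θ < 1) :
    ContinuousOn (dExp θ) (Set.Ioi 0) := by
  unfold dExp
  refine continuousOn_const.mul (ContinuousOn.log (ContinuousOn.div (by fun_prop) (by fun_prop)
    fun x hx => (chernoff_denom_pos hθ hθ1 (le_of_lt hx)).ne') fun x hx => ?_)
  have hden := chernoff_denom_pos hθ hθ1 (le_of_lt (Set.mem_Ioi.1 hx))
  have hE := exp_pos x
  positivity

lemma mul_exp_le_VLB {g' : ℝ → ℝ} (hθ : 1/2 < θ) (hθ1 : θ < 1) (hg' : 0 ≤ g' ε) :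
    g' ε * rexp ε ≤ VLB θ g' ε := by
  have hE := exp_pos ε
  have hc : 1 ≤ θ / (2 * θ - 1) := by
    rw [one_le_div (by linarith)]
    linarith
  have h1 : 1 ≤ (rexp ε + 1) / rexp ε := by
    rw [one_le_div hE]
    linarith
  have h2 : rexp ε ≤ θ / (2 * θ - 1) * (rexp ε + 1) - 1 := by nlinarith
  exact mul_le_mul (le_mul_of_one_le_right hg' h1) h2 hE.le (by positivity)

lemma continuousOn_VLB {g g' : ℝ → ℝ} (hg : ProperCost g g') :
    ContinuousOn (VLB θ g') (Set.Ioi 0) := by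
  unfold VLB
  have h : ContinuousOn g' (Set.Ioi 0) := hg.derivCont.mono Set.Ioi_subset_Ici_self
  exact (h.mul (ContinuousOn.div (by fun_prop) (by fun_prop) fun x _ => (exp_pos x).ne')).mul
    (by fun_prop)

end Factors

/-- **Well-definedness of `ε̃`:** the quality/price ratio `r(ε) = D(ε)/V_LB(ε)` is
continuous and strictly positive on `(0,∞)`, tends to `0` as `ε → 0⁺` (assuming
additionally `D(ε)/g'(ε) → 0` as `ε → 0⁺`) and as `ε → +∞`, attains its maximum on
`(0,∞)`, and its set of maximizers has a least element. -/
theorem best_ratio_well_defined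
    (θ : ℝ) (hθ : 1/2 < θ) (hθ1 : θ < 1)
    (g g' : ℝ → ℝ) (hg : ProperCost g g')
    (hlim : Tendsto (fun ε => dExp θ ε / g' ε) (nhdsWithin 0 (Set.Ioi 0)) (nhds 0)) :
    ContinuousOn (fun ε => dExp θ ε / VLB θ g' ε) (Set.Ioi 0) ∧
    (∀ ε : ℝ, 0 < ε → 0 < dExp θ ε / VLB θ g' ε) ∧
    Tendsto (fun ε => dExp θ ε / VLB θ g' ε) (nhdsWithin 0 (Set.Ioi 0)) (nhds 0) ∧
    Tendsto (fun ε => dExp θ ε / VLB θ g' ε) atTop (nhds 0) ∧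
    ∃ εt : ℝ, IsLeast {ε : ℝ | 0 < ε ∧ ∀ ε' : ℝ, 0 < ε' →
      dExp θ ε' / VLB θ g' ε' ≤ dExp θ ε / VLB θ g' ε} εt := by
  have hV : ∀ ε : ℝ, 0 < ε → g' ε * rexp ε ≤ VLB θ g' ε := fun ε hε =>
    mul_exp_le_VLB hθ hθ1 (hg.deriv_pos hε).le
  have hVpos : ∀ ε : ℝ, 0 < ε → 0 < VLB θ g' ε := fun ε hε =>
    (mul_pos (hg.deriv_pos hε) (exp_pos ε)).trans_le (hV ε hε)
  have hcont : ContinuousOn (fun ε => dExp θ ε / VLB θ g' ε) (Set.Ioi 0) :=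
    (continuousOn_dExp hθ hθ1).div (continuousOn_VLB hg) fun ε hε => (hVpos ε hε).ne'
  have hpos : ∀ ε : ℝ, 0 < ε → 0 < dExp θ ε / VLB θ g' ε := fun ε hε =>
    div_pos (dExp_pos hθ hθ1 hε) (hVpos ε hε)
  have hzero : Tendsto (fun ε => dExp θ ε / VLB θ g' ε) (nhdsWithin 0 (Set.Ioi 0)) (nhds 0) := by
    refine tendsto_of_tendsto_of_tendsto_of_le_of_le' tendsto_const_nhds hlim ?_ ?_
    · filter_upwards [self_mem_nhdsWithin] with ε hε using (hpos ε hε).le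
    · filter_upwards [self_mem_nhdsWithin] with ε hε
      have hg' := hg.deriv_pos hε
      exact div_le_div_of_nonneg_left (dExp_pos hθ hθ1 hε).le hg'
        ((le_mul_of_one_le_right hg'.le (one_le_exp (le_of_lt hε))).trans (hV ε hε))
  have htop : Tendsto (fun ε => dExp θ ε / VLB θ g' ε) atTop (nhds 0) := by
    have hg1 : 0 < g 1 := hg.pos 1 one_pos
    have hbound : Tendsto (fun ε => (1/2) * Real.log (1 / (2 * (1 - θ))) / (g 1 * rexp ε))
        atTop (nhds 0) :=
      tendsto_const_nhds.div_atTop (tendsto_exp_atTop.const_mul_atTop hg1)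
    refine tendsto_of_tendsto_of_tendsto_of_le_of_le' tendsto_const_nhds hbound ?_ ?_
    · filter_upwards [eventually_gt_atTop 0] with ε hε using (hpos ε hε).le
    · filter_upwards [eventually_ge_atTop 1] with ε hε
      have hε0 : 0 < ε := one_pos.trans_le hε
      have hD := dExp_le hθ hθ1 hε0.le
      refine div_le_div₀ ((dExp_pos hθ hθ1 hε0).le.trans hD) hD (by positivity) ?_
      exact (mul_le_mul_of_nonneg_right (hg.apply_one_le_deriv hε) (exp_pos ε).le).trans
        (hV ε hε0)
  exact ⟨hcont, hpos, hzero, htop, exists_isLeast_maximizers hcont hpos hzero htop⟩
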